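/- Let q be an odd prime power, let f ∈ F_q[x] be a dynamically 2-ordinary polynomial of degree d ≥ 2, and let L be a positive integer. Then for every function ε : {1,…,L} → {−1, 0, 1}, the real number Σ_{x ∈ F_q} ∏_{ℓ=1}^{L} (1 + ε(ℓ)·χ(f^ℓ(x)))/2 is at most q/2^L + d^{L+1}·√q. -/

import Mathlib

open Polynomial

/-- The `n`-th iterate of a polynomial under composition, with `f^0 = X`. -/
noncomputable def polyIter {K : Type*} [CommRing K] (f : K[X]) : ℕ → K[X]
  | 0 => X
  | n + 1 => f.comp (polyIter f n)

/-- `f` is dynamically 2-ordinary: for every `n ≥ 1` there is an irreducible factor of `f^n`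
with odd multiplicity in `f^n` that does not divide `f^i` for any `i < n`. -/
def DynTwoOrdinary {K : Type*} [Field K] (f : K[X]) : Prop :=
  ∀ n : ℕ, 1 ≤ n → ∃ g : K[X], Irreducible g ∧
    (∃ e : ℕ, Odd e ∧ g ^ e ∣ polyIter f n ∧ ¬ g ^ (e + 1) ∣ polyIter f n) ∧
    ∀ i : ℕ, i < n → ¬ g ∣ polyIter f i

open Classical in
/-- The real-valued quadratic character of a field: `χ(0) = 0`, `χ(x) = 1` if `x` is a
nonzero square, `χ(x) = −1` otherwise. -/
noncomputable def chiR {F : Type*} [Field F] (x : F) : ℝ :=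
  if x = 0 then 0 else if IsSquare x then 1 else -1


theorem hasse_dvd {F : Type*} [Field F] (g r : F[X]) (n : ℕ) : ∀ k : ℕ,
    g ^ (n - k) ∣ hasseDeriv k (g ^ n * r) := by
  induction n with
  | zero => intro k; simp
  | succ n ih =>
    intro k
    rw [pow_succ', mul_assoc, hasseDeriv_mul]
    apply Finset.dvd_sum
    rintro ⟨i, j⟩ hij
    rw [Finset.HasAntidiagonal.mem_antidiagonal] at hij
    simp only at hij ⊢
    rcases Nat.eq_zero_or_pos i with rfl | hi
    · rw [hasseDeriv_zero', ]
      have h1 : g ^ (n + 1 - k) ∣ g * g ^ (n - j) := by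
        rw [← pow_succ']; exact pow_dvd_pow _ (by omega)
      exact h1.trans (mul_dvd_mul_left _ (ih j))
    · exact ((pow_dvd_pow g (by omega)).trans (ih j)).mul_left _

theorem hasse_lin {F : Type*} [Field F] (g : F[X]) (hg : g ≠ 0) (n k : ℕ) :
    ∃ u : F[X] →ₗ[F] F[X], ∀ r, hasseDeriv k (g ^ n * r) = g ^ (n - k) * u r := by
  have hinj : Function.Injective (LinearMap.mulLeft F (g ^ (n - k))) := by
    intro a b hab
    exact mul_left_cancel₀ (pow_ne_zero _ hg) hab
  let e := LinearEquiv.ofInjective _ hinj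
  let A : F[X] →ₗ[F] F[X] := (hasseDeriv k : F[X] →ₗ[F] F[X]) ∘ₗ LinearMap.mulLeft F (g ^ n)
  have hA : ∀ r, A r ∈ LinearMap.range (LinearMap.mulLeft F (g ^ (n - k))) := by
    intro r
    obtain ⟨c, hc⟩ := hasse_dvd g r n k
    exact ⟨c, hc.symm⟩
  refine ⟨e.symm.toLinearMap ∘ₗ A.codRestrict _ hA, fun r => ?_⟩
  have := congrArg Subtype.val (e.apply_symm_apply (A.codRestrict _ hA r))
  exact this.symm

theorem hasse_deg {F : Type*} [Field F] (g : F[X]) (hg : g ≠ 0) (n k : ℕ) (hk : k ≤ n)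
    (hD : 1 ≤ g.natDegree)
    (u r : F[X]) (h : hasseDeriv k (g ^ n * r) = g ^ (n - k) * u) :
    u.natDegree ≤ r.natDegree + k * (g.natDegree - 1) := by
  by_cases hu : u = 0
  · simp [hu]
  have h1 := natDegree_hasseDeriv_le (g ^ n * r) k
  rw [h, natDegree_mul (pow_ne_zero _ hg) hu, natDegree_pow] at h1
  have h2 : (g ^ n * r).natDegree ≤ n * g.natDegree + r.natDegree := by
    refine natDegree_mul_le.trans ?_
    rw [natDegree_pow]
  obtain ⟨D, hD'⟩ : ∃ D, g.natDegree = D + 1 := ⟨g.natDegree - 1, by omega⟩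
  obtain ⟨m, rfl⟩ : ∃ m, n = k + m := ⟨n - k, by omega⟩
  rw [hD'] at h1 h2 ⊢
  simp only [Nat.add_sub_cancel, Nat.add_sub_cancel_left] at *
  have e1 : (k + m) * (D + 1) = k * D + k + m * (D + 1) := by ring
  omega

theorem hasse_mul_Xq {F : Type*} [Field F] [Fintype F] (P : F[X]) (k : ℕ)
    (hk : k < Fintype.card F) :
    hasseDeriv k (P * X ^ Fintype.card F) = hasseDeriv k P * X ^ Fintype.card F := by
  obtain ⟨p, hcp, n, hp, hc⟩ := FiniteField.card' F
  have hp' := hp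
  rw [hasseDeriv_mul, Finset.sum_eq_single (k, 0)]
  · simp
  · rintro ⟨i, j⟩ hij hne
    rw [Finset.HasAntidiagonal.mem_antidiagonal] at hij
    have hj : j ≠ 0 := by
      rintro rfl
      apply hne
      simp at hij
      simp [hij]
    simp only at hij ⊢
    have : (((Fintype.card F).choose j : ℕ) : F) = 0 := by
      rw [CharP.cast_eq_zero_iff F p, hc]
      exact hp'.dvd_choose_pow hj (by omega)
    have h2 : hasseDeriv j (X ^ Fintype.card F : F[X]) = 0 := by
      rw [← monomial_one_right_eq_X_pow, hasseDeriv_monomial, this]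
      simp
    rw [h2, mul_zero]
  · simp

theorem hasse_mul_Xqj {F : Type*} [Field F] [Fintype F] (P : F[X]) (k : ℕ)
    (hk : k < Fintype.card F) (j : ℕ) :
    hasseDeriv k (P * (X ^ Fintype.card F) ^ j) = hasseDeriv k P * (X ^ Fintype.card F) ^ j := by
  induction j with
  | zero => simp
  | succ j ih => rw [pow_succ, ← mul_assoc, hasse_mul_Xq _ _ hk, ih, mul_assoc]

theorem nonvan {F : Type*} [Field F] [Fintype F] (g : F[X]) (m : ℕ)
    (hm : Fintype.card F = 2 * m + 1) (hg0 : g.coeff 0 ≠ 0)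
    (hsq : ∀ r s : F[X], ∀ c : F, g * r ^ 2 = C c * s ^ 2 → r = 0) (J : ℕ) :
    ∀ r s : ℕ → F[X], (∀ j, 2 * (r j).natDegree + g.natDegree < Fintype.card F) →
      (∀ j, 2 * (s j).natDegree < Fintype.card F) →
      ∑ j ∈ Finset.range J, (r j + s j * g ^ m) * (X ^ Fintype.card F) ^ j = 0 →
      ∀ j < J, r j = 0 ∧ s j = 0 := by
  induction J with
  | zero => intro r s _ _ _ j hj; omega
  | succ J ih =>
    intro r s hr hs h
    rw [Finset.sum_range_succ'] at h
    set A := ∑ j ∈ Finset.range J, (r (j+1) + s (j+1) * g ^ m) * (X ^ Fintype.card F) ^ j with hA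
    have h1 : ∑ j ∈ Finset.range J, (r (j+1) + s (j+1) * g ^ m) * (X ^ Fintype.card F) ^ (j + 1)
        = X ^ Fintype.card F * A := by
      rw [hA, Finset.mul_sum]
      refine Finset.sum_congr rfl fun j _ => by ring
    rw [h1] at h
    have h2 : r 0 = - (s 0 * g ^ m) - X ^ Fintype.card F * A := by linear_combination h
    have hgq : (X : F[X]) ^ Fintype.card F ∣ g ^ Fintype.card F - C (g.coeff 0) := by
      rw [← FiniteField.expand_card g, X_pow_dvd_iff]
      intro d hd
      rw [coeff_sub, coeff_expand (by omega), coeff_C]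
      split_ifs with h3 h4 h4
      · subst h4; simp
      · exact absurd (Nat.le_of_dvd (by omega) h3) (by omega)
      · subst h4; simp at h3
      · simp
    have h3 : (X : F[X]) ^ Fintype.card F ∣ g * r 0 ^ 2 - C (g.coeff 0) * s 0 ^ 2 := by
      obtain ⟨B, hB⟩ := hgq
      have e : g ^ Fintype.card F = g * (g ^ m) ^ 2 := by rw [hm]; ring
      rw [e] at hB
      refine ⟨B * s 0 ^ 2 + 2 * g * s 0 * g ^ m * A + g * X ^ Fintype.card F * A ^ 2, ?_⟩
      rw [h2]
      linear_combination (s 0)^2 * hB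
    have h4 : g * r 0 ^ 2 - C (g.coeff 0) * s 0 ^ 2 = 0 := by
      by_contra hne
      have := natDegree_le_of_dvd h3 hne
      rw [natDegree_X_pow] at this
      have t1 : (g * r 0 ^ 2).natDegree ≤ g.natDegree + 2 * (r 0).natDegree := by
        refine natDegree_mul_le.trans ?_
        rw [natDegree_pow]
      have t2 : (C (g.coeff 0) * s 0 ^ 2).natDegree ≤ 2 * (s 0).natDegree := by
        refine (natDegree_C_mul_le _ _).trans ?_
        rw [natDegree_pow]
      have t3 := natDegree_sub_le (g * r 0 ^ 2) (C (g.coeff 0) * s 0 ^ 2)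
      have := hr 0
      have := hs 0
      omega
    have hr0 : r 0 = 0 := hsq _ _ _ (sub_eq_zero.1 h4)
    have hs0 : s 0 = 0 := by
      rw [hr0] at h4
      simpa [hg0] using h4
    have hA0 : A = 0 := by
      rw [hr0, hs0] at h
      simpa using h
    intro j hj
    rcases j with _ | j
    · exact ⟨hr0, hs0⟩
    · exact ih (fun j => r (j+1)) (fun j => s (j+1)) (fun j => hr _) (fun j => hs _) hA0 j (by omega)

theorem pow_dvd_of_hasse {F : Type*} [Field F] (H : F[X]) (l : ℕ) (x : F)
    (h : ∀ k < l, (hasseDeriv k H).eval x = 0) : (X - C x) ^ l ∣ H := by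
  rw [X_sub_C_pow_dvd_iff, X_pow_dvd_iff]
  intro d hd
  have := h d hd
  rwa [← taylor_coeff] at this

theorem card_mul_le {F : Type*} [Field F] (H : F[X]) (hH : H ≠ 0) (l : ℕ) (Z : Finset F)
    (h : ∀ x ∈ Z, (X - C x) ^ l ∣ H) : Z.card * l ≤ H.natDegree := by
  have h1 : ∏ x ∈ Z, (X - C x) ^ l ∣ H := by
    apply Finset.prod_dvd_of_coprime _ h
    intro a _ b _ hab
    exact ((pairwise_coprime_X_sub_C Function.injective_id) hab).pow
  have h2 := natDegree_le_of_dvd h1 hH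
  rw [natDegree_prod _ _ (fun x _ => pow_ne_zero _ (X_sub_C_ne_zero x))] at h2
  simpa [natDegree_pow] using h2

theorem natDeg_of_mem {F : Type*} [Field F] (E : ℕ) (p : F[X]) (hp : p ∈ degreeLT F E) :
    p.natDegree ≤ E - 1 := by
  by_cases h0 : p = 0
  · simp [h0]
  rw [mem_degreeLT] at hp
  have := (natDegree_lt_iff_degree_lt h0).2 hp
  omega

theorem stepanov {F : Type*} [Field F] [Fintype F] (g : F[X]) (m : ℕ)
    (hm : Fintype.card F = 2 * m + 1) (hg0 : g.coeff 0 ≠ 0)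
    (hsq : ∀ r s : F[X], ∀ c : F, g * r ^ 2 = C c * s ^ 2 → r = 0)
    (hD : 1 ≤ g.natDegree) (a : F) (l E J J' N : ℕ) (hl : l ≤ Fintype.card F)
    (hE : 2 * (E - 1) + g.natDegree < Fintype.card F) (hE1 : 1 ≤ E) (hJ : J' ≤ J) (hJ1 : 1 ≤ J)
    (hdim : ∑ k ∈ Finset.range l, (E + J - 1 + k * (g.natDegree - 1)) < (J + J') * E)
    (Z : Finset F) (hZ : ∀ x ∈ Z, g.eval x = 0 ∨ g.eval x ^ m = a)
    (hr : (J - 1) * Fintype.card F + (E - 1) ≤ N)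
    (hs : (J' - 1) * Fintype.card F + m * g.natDegree + (E - 1) ≤ N) :
    Z.card * l ≤ l * g.natDegree + N := by
  classical
  have hg : g ≠ 0 := by rintro rfl; simp at hg0
  choose u hu using fun k => hasse_lin g hg l k
  choose v hv using fun k => hasse_lin g hg (l + m) k
  let V := (Fin J → degreeLT F E) × (Fin J' → degreeLT F E)
  let ρ : ℕ → V →ₗ[F] F[X] := fun j => if h : j < J then
    (degreeLT F E).subtype ∘ₗ LinearMap.proj (⟨j, h⟩ : Fin J) ∘ₗ LinearMap.fst F _ _ else 0
  let σ : ℕ → V →ₗ[F] F[X] := fun j => if h : j < J' then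
    (degreeLT F E).subtype ∘ₗ LinearMap.proj (⟨j, h⟩ : Fin J') ∘ₗ LinearMap.snd F _ _ else 0
  have hρ : ∀ j w, (ρ j w).natDegree ≤ E - 1 := by
    intro j w
    by_cases h : j < J
    · simp only [ρ, dif_pos h]
      exact natDeg_of_mem E _ (w.1 ⟨j, h⟩).2
    · simp [ρ, dif_neg h]
  have hσ : ∀ j w, (σ j w).natDegree ≤ E - 1 := by
    intro j w
    by_cases h : j < J'
    · simp only [σ, dif_pos h]
      exact natDeg_of_mem E _ (w.2 ⟨j, h⟩).2
    · simp [σ, dif_neg h]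
  have hσ0 : ∀ j w, J' ≤ j → σ j w = 0 := by
    intro j w hj
    simp [σ, not_lt.2 hj]
  let T : ℕ → V →ₗ[F] F[X] := fun k => ∑ j ∈ Finset.range J,
    LinearMap.mulRight F (X ^ j : F[X]) ∘ₗ (u k ∘ₗ ρ j + a • (v k ∘ₗ σ j))
  have hT : ∀ k w, T k w = ∑ j ∈ Finset.range J,
      (u k (ρ j w) + C a * v k (σ j w)) * X ^ j := by
    intro k w
    simp [T, smul_eq_C_mul]
  let n : ℕ → ℕ := fun k => E + J - 1 + k * (g.natDegree - 1)
  have hTdeg : ∀ k < l, ∀ w, (T k w).natDegree < n k := by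
    intro k hk w
    have : (T k w).natDegree ≤ E - 1 + (J - 1) + k * (g.natDegree - 1) := by
      rw [hT]
      apply natDegree_sum_le_of_forall_le
      intro j hj
      rw [Finset.mem_range] at hj
      refine natDegree_mul_le.trans ?_
      rw [natDegree_X_pow]
      have h1 := hasse_deg g hg l k hk.le hD _ _ (hu k (ρ j w))
      have h2 := hasse_deg g hg (l + m) k (by omega) hD _ _ (hv k (σ j w))
      have h3 := natDegree_add_le (u k (ρ j w)) (C a * v k (σ j w))
      have h4 := natDegree_C_mul_le a (v k (σ j w))
      have h5 := hρ j w
      have h6 := hσ j w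
      omega
    simp only [n]
    omega
  let Φ : V →ₗ[F] ((k : Fin l) → Fin (n k) → F) :=
    LinearMap.pi fun k => LinearMap.pi fun i => lcoeff F i ∘ₗ T k
  have hfE : Module.finrank F (degreeLT F E) = E := by
    rw [(degreeLTEquiv F E).finrank_eq]; simp
  have : Module.Finite F (degreeLT F E) := Module.Finite.equiv (degreeLTEquiv F E).symm
  have hker : LinearMap.ker Φ ≠ ⊥ := by
    apply LinearMap.ker_ne_bot_of_finrank_lt
    have e1 : Module.finrank F V = (J + J') * E := by
      simp only [V]
      rw [Module.finrank_prod, Module.finrank_pi_fintype, Module.finrank_pi_fintype]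
      simp [hfE]
      ring
    have e2 : Module.finrank F ((k : Fin l) → Fin (n k) → F) = ∑ k ∈ Finset.range l, n k := by
      rw [Module.finrank_pi_fintype, Finset.sum_range]
      simp
    rw [e1, e2]
    exact hdim
  obtain ⟨w, hw, hw0⟩ := (Submodule.ne_bot_iff _).1 hker
  have hTw : ∀ k < l, T k w = 0 := by
    intro k hk
    ext i
    by_cases hi : i < n k
    · have := congrFun (congrFun (LinearMap.mem_ker.1 hw) ⟨k, hk⟩) ⟨i, hi⟩
      simpa [Φ] using this
    · rw [coeff_eq_zero_of_natDegree_lt]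
      · simp
      · exact (hTdeg k hk w).trans_le (not_lt.1 hi)
  set P := ∑ j ∈ Finset.range J, (ρ j w + σ j w * g ^ m) * (X ^ Fintype.card F) ^ j with hP
  have hP0 : P ≠ 0 := by
    intro h0
    have key := nonvan g m hm hg0 hsq J (fun j => ρ j w) (fun j => σ j w)
      (fun j => by have := hρ j w; show 2 * (ρ j w).natDegree + _ < _; omega)
      (fun j => by have := hσ j w; show 2 * (σ j w).natDegree < _; omega) h0
    apply hw0
    apply Prod.ext
    · funext i
      have := (key i i.2).1
      simp only [ρ, dif_pos i.2] at this
      exact Subtype.ext this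
    · funext i
      have := (key i (i.2.trans_le hJ)).2
      simp only [σ, dif_pos i.2] at this
      exact Subtype.ext this
  have hPdeg : P.natDegree ≤ N := by
    rw [hP]
    apply natDegree_sum_le_of_forall_le
    intro j hj
    rw [Finset.mem_range] at hj
    have h5 := hρ j w
    have h6 := hσ j w
    rw [add_mul]
    refine (natDegree_add_le _ _).trans (max_le ?_ ?_)
    · refine natDegree_mul_le.trans ?_
      rw [← pow_mul, natDegree_X_pow]
      have : Fintype.card F * j ≤ (J - 1) * Fintype.card F := by
        rw [mul_comm]; exact Nat.mul_le_mul_right _ (by omega)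
      omega
    · by_cases hj' : j < J'
      · refine natDegree_mul_le.trans ?_
        rw [← pow_mul, natDegree_X_pow]
        have h7 : (σ j w * g ^ m).natDegree ≤ (σ j w).natDegree + m * g.natDegree := by
          refine natDegree_mul_le.trans ?_
          rw [natDegree_pow]
        have : Fintype.card F * j ≤ (J' - 1) * Fintype.card F := by
          rw [mul_comm]; exact Nat.mul_le_mul_right _ (by omega)
        omega
      · rw [hσ0 j w (not_lt.1 hj')]
        simp
  have hHd : ∀ k < l, hasseDeriv k (g ^ l * P) = g ^ (l - k) * ∑ j ∈ Finset.range J,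
      (u k (ρ j w) + v k (σ j w) * g ^ m) * (X ^ Fintype.card F) ^ j := by
    intro k hk
    rw [hP, Finset.mul_sum, Finset.mul_sum, map_sum]
    refine Finset.sum_congr rfl fun j _ => ?_
    have e : g ^ l * ((ρ j w + σ j w * g ^ m) * (X ^ Fintype.card F) ^ j)
      = (g ^ l * ρ j w + g ^ (l + m) * σ j w) * (X ^ Fintype.card F) ^ j := by ring
    rw [e, hasse_mul_Xqj _ _ (by omega), map_add, hu, hv,
      show l + m - k = (l - k) + m by omega]
    ring
  have hmain := card_mul_le (g ^ l * P) (mul_ne_zero (pow_ne_zero _ hg) hP0) l Z (by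
    intro x hx
    apply pow_dvd_of_hasse
    intro k hk
    rw [hHd k hk, eval_mul, eval_pow]
    rcases hZ x hx with h | h
    · rw [h, zero_pow (by omega), zero_mul]
    · have := congrArg (eval x) (hTw k hk)
      rw [hT, eval_zero] at this
      rw [← mul_zero (eval x g ^ (l - k)), ← this]
      congr 1
      rw [eval_finsetSum, eval_finsetSum]
      refine Finset.sum_congr rfl fun j _ => ?_
      simp only [eval_mul, eval_add, eval_pow, eval_X, eval_C, FiniteField.pow_card, h]
      ring)
  refine hmain.trans ?_
  rw [natDegree_mul (pow_ne_zero _ hg) hP0, natDegree_pow]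
  omega

theorem count_bound {F : Type*} [Field F] [Fintype F] (g : F[X]) (m : ℕ)
    (hm : Fintype.card F = 2 * m + 1) (hg0 : g.coeff 0 ≠ 0)
    (hsq : ∀ r s : F[X], ∀ c : F, g * r ^ 2 = C c * s ^ 2 → r = 0)
    (hD : 1 ≤ g.natDegree) (a : F) (s : ℕ) (hs : s * s ≤ Fintype.card F)
    (hsD : 2 * g.natDegree + 2 ≤ s)
    (Z : Finset F) (hZ : ∀ x ∈ Z, g.eval x = 0 ∨ g.eval x ^ m = a) :
    2 * (Z.card * s) ≤ 2 * (s * g.natDegree) + (s + 2 * g.natDegree) * Fintype.card F := by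
  set D := g.natDegree with hDdef
  set q := Fintype.card F with hqdef
  have hsq1 : (2 * D + 2) * s ≤ s * s := Nat.mul_le_mul_right _ hsD
  have hss : s ≤ s * s := by nlinarith
  have hDq : D + 3 ≤ q := by nlinarith
  obtain ⟨E, hE1, hE2, hE3⟩ : ∃ E, 1 ≤ E ∧ q ≤ 2 * E + D ∧ 2 * E + D ≤ q + 1 :=
    ⟨(q - 1 - D) / 2 + 1, by omega, by omega, by omega⟩
  obtain ⟨J, J', hJ, hJJ, hJ2⟩ : ∃ J J' : ℕ, J' ≤ J ∧ J + J' = s + D + 1 ∧ J ≤ J' + 1 :=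
    ⟨s + D + 1 - (s + D + 1) / 2, (s + D + 1) / 2, by omega, by omega, by omega⟩
  obtain ⟨j, rfl⟩ : ∃ j, J = j + 1 := ⟨J - 1, by omega⟩
  obtain ⟨j', rfl⟩ : ∃ j, J' = j + 1 := ⟨J' - 1, by omega⟩
  obtain ⟨e, rfl⟩ : ∃ e, E = e + 1 := ⟨E - 1, by omega⟩
  obtain ⟨D1, hD1⟩ : ∃ D1, D = D1 + 1 := ⟨D - 1, by omega⟩
  have hdim : ∑ k ∈ Finset.range s, (e + 1 + (j + 1) - 1 + k * (D - 1))
      < (j + 1 + (j' + 1)) * (e + 1) := by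
    rw [Finset.sum_add_distrib, ← Finset.sum_mul]
    have h2 := Finset.sum_range_id_mul_two s
    set G := ∑ k ∈ Finset.range s, k
    obtain ⟨s1, hs1⟩ : ∃ s1, s = s1 + 1 := ⟨s - 1, by omega⟩
    simp only [Finset.sum_const, Finset.card_range, smul_eq_mul]
    rw [show D - 1 = D1 by omega, show e + 1 + (j + 1) - 1 = e + 1 + j by omega, hJJ]
    rw [show s - 1 = s1 by omega] at h2
    have hj : 2 * j ≤ s + D := by omega
    have a1 : 2 * (s * j) ≤ s * (s + D) := by nlinarith
    have a2 : (D + 1) * q ≤ (D + 1) * (2 * (e + 1) + D) := Nat.mul_le_mul_left _ hE2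
    have a3 : (D + 1) * (s * s) ≤ (D + 1) * q := Nat.mul_le_mul_left _ hs
    have a4 : G * 2 * D1 = s * s1 * D1 := by rw [h2]
    have a5 : s * s1 * D1 + D1 * s = D1 * (s * s) := by rw [hs1]; ring
    have a6 : D * (D + 1) + s < s * s := by nlinarith
    have a7 : D * (s * s) = D1 * (s * s) + s * s := by rw [hD1]; ring
    have a8 : D * s = D1 * s + s := by rw [hD1]; ring
    nlinarith
  have hjq : 2 * j * q ≤ (s + D) * q := Nat.mul_le_mul_right _ (by omega)
  have hjq' : (2 * j' + 1) * q ≤ (s + D) * q := Nat.mul_le_mul_right _ (by omega)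
  have hDq' : q ≤ D * q := Nat.le_mul_of_pos_left _ hD
  have hmD : 2 * (m * D) + D = D * q := by rw [hm]; ring
  have hst := stepanov g m hm hg0 hsq hD a s (e + 1) (j + 1) (j' + 1)
    (max (j * q + e) (j' * q + m * D + e)) (hss.trans hs) (by simp only [Nat.add_sub_cancel]; omega) hE1 hJ (by omega) hdim Z hZ
    (by simp [← hqdef]) (by simp [← hqdef, ← hDdef])
  have : 2 * max (j * q + e) (j' * q + m * D + e) ≤ (s + 2 * D) * q := by
    rcases max_cases (j * q + e) (j' * q + m * D + e) with ⟨h, _⟩ | ⟨h, _⟩ <;> rw [h] <;> nlinarith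
  rw [← hDdef] at hst
  omega

theorem chiR_abs {F : Type*} [Field F] (x : F) : |chiR x| ≤ 1 := by
  unfold chiR
  split_ifs <;> simp

theorem chiR_mul {F : Type*} [Field F] [Fintype F] (x y : F) :
    chiR (x * y) = chiR x * chiR y := by
  classical
  have h : ∀ x : F, chiR x = ((quadraticChar F x : ℤ) : ℝ) := by
    intro x
    rw [quadraticChar_apply, quadraticCharFun, chiR]
    split_ifs <;> simp
  rw [h, h, h, map_mul]
  push_cast
  rfl

theorem chi_aux {F : Type*} [Field F] [Fintype F] [DecidableEq F] (m : ℕ)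
    (hm : Fintype.card F = 2 * m + 1) (y : F) :
    chiR y ≤ 2 * (if y = 0 ∨ y ^ m = 1 then 1 else 0) - 1 ∧
    -chiR y ≤ 2 * (if y = 0 ∨ y ^ m = -1 then 1 else 0) - 1 := by
  have hc : ringChar F ≠ 2 := by
    intro h
    have := FiniteField.even_card_iff_char_two.1 h
    omega
  have hm2 : Fintype.card F / 2 = m := by omega
  by_cases h0 : y = 0
  · simp [chiR, h0]
  have h1 := FiniteField.isSquare_iff hc h0
  have h2 := FiniteField.pow_dichotomy hc h0
  rw [hm2] at h1 h2
  unfold chiR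
  rw [if_neg h0]
  by_cases hs : IsSquare y
  · have := h1.1 hs
    constructor
    · rw [if_pos hs, if_pos (Or.inr this)]; norm_num
    · rw [if_pos hs]; split_ifs <;> norm_num
  · have := h2.resolve_left (fun h => hs (h1.2 h))
    constructor
    · rw [if_neg hs]; split_ifs <;> norm_num
    · rw [if_neg hs, if_pos (Or.inr this)]; norm_num

theorem arith_fin (D s t z q : ℝ) (hD : 0 ≤ D) (hs : 0 < s) (hst : s ≤ t) (hts : t ≤ s + 1)
    (hsD : 2 * D + 2 ≤ s) (ht : t * t = q)
    (h : 2 * (z * s) ≤ 2 * (s * D) + (s + 2 * D) * q) : 2 * z - q ≤ (2 * D + 2) * t := by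
  have h1 : (2 * z - q) * s ≤ ((2 * D + 2) * t) * s := by
    have e1 : D * (t * t) ≤ D * (t * (s + 1)) := by
      apply mul_le_mul_of_nonneg_left _ hD
      exact mul_le_mul_of_nonneg_left hts (by linarith)
    have e2 : 2 * D * t ≤ s * t := mul_le_mul_of_nonneg_right (by linarith) (by linarith)
    have e3 : s * (2 * D) ≤ s * t := mul_le_mul_of_nonneg_left (by linarith) (by linarith)
    rw [← ht] at h ⊢
    nlinarith
  exact le_of_mul_le_mul_right h1 hs

theorem weil0 {F : Type*} [Field F] [Fintype F] (hq : Odd (Fintype.card F)) (g : F[X])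
    (hg0 : g.coeff 0 ≠ 0)
    (hsq : ∀ r s : F[X], ∀ c : F, g * r ^ 2 = C c * s ^ 2 → r = 0)
    (hD : 1 ≤ g.natDegree)
    (hbig : 2 * (g.natDegree : ℝ) + 2 < Real.sqrt (Fintype.card F)) :
    |∑ x : F, chiR (g.eval x)| ≤ (2 * g.natDegree + 2) * Real.sqrt (Fintype.card F) := by
  classical
  obtain ⟨m, hm⟩ := hq
  set s := Nat.sqrt (Fintype.card F) with hs
  have hss : s * s ≤ Fintype.card F := Nat.sqrt_le _
  have hsD : 2 * g.natDegree + 2 ≤ s := by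
    rw [hs, Nat.le_sqrt']
    have : ((2 * g.natDegree + 2 : ℕ) : ℝ) < Real.sqrt (Fintype.card F) := by push_cast; exact hbig
    have h2 := (Real.lt_sqrt (by positivity)).1 this
    exact_mod_cast h2.le
  have main : ∀ a : F, 2 * (((Finset.univ.filter
      fun x => g.eval x = 0 ∨ g.eval x ^ m = a).card : ℕ) : ℝ) - (Fintype.card F : ℝ)
      ≤ (2 * g.natDegree + 2) * Real.sqrt (Fintype.card F) := by
    intro a
    have h := count_bound g m hm hg0 hsq hD a s hss hsD
      (Finset.univ.filter fun x => g.eval x = 0 ∨ g.eval x ^ m = a) (by simp)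
    refine arith_fin _ (s : ℝ) _ _ _ (by positivity) ?_ ?_ ?_ ?_ ?_ ?_
    · exact_mod_cast (by omega : 0 < s)
    · apply Real.le_sqrt_of_sq_le
      rw [sq]; exact_mod_cast hss
    · rw [Real.sqrt_le_left (by positivity)]
      have := Nat.lt_succ_sqrt (Fintype.card F)
      rw [sq]; exact_mod_cast this.le
    · exact_mod_cast hsD
    · exact Real.mul_self_sqrt (by positivity)
    · exact_mod_cast h
  have conv : ∀ a : F, ∑ x : F, ((2 : ℝ) * (if g.eval x = 0 ∨ g.eval x ^ m = a then 1 else 0) - 1)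
      = 2 * (((Finset.univ.filter
      fun x => g.eval x = 0 ∨ g.eval x ^ m = a).card : ℕ) : ℝ) - (Fintype.card F : ℝ) := by
    intro a
    rw [Finset.sum_sub_distrib, ← Finset.mul_sum, Finset.sum_boole]
    simp
  rw [abs_le']
  constructor
  · refine le_trans ?_ (main 1)
    rw [← conv]
    exact Finset.sum_le_sum fun x _ => (chi_aux m hm _).1
  · refine le_trans ?_ (main (-1))
    rw [← conv, ← Finset.sum_neg_distrib]
    exact Finset.sum_le_sum fun x _ => (chi_aux m hm _).2

theorem weil {F : Type*} [Field F] [Fintype F] (hq : Odd (Fintype.card F)) (g : F[X])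
    (hsq : ∀ r s : F[X], ∀ c : F, g * r ^ 2 = C c * s ^ 2 → r = 0)
    (hD : 1 ≤ g.natDegree) :
    |∑ x : F, chiR (g.eval x)| ≤ (2 * g.natDegree + 2) * Real.sqrt (Fintype.card F) := by
  classical
  rcases le_or_gt (Real.sqrt (Fintype.card F)) (2 * (g.natDegree : ℝ) + 2) with hsm | hbig
  · have h1 : |∑ x : F, chiR (g.eval x)| ≤ (Fintype.card F : ℝ) := by
      refine (Finset.abs_sum_le_sum_abs _ _).trans ?_
      refine (Finset.sum_le_sum fun x _ => chiR_abs _).trans ?_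
      simp
    refine h1.trans ?_
    nth_rw 1 [← Real.mul_self_sqrt (Nat.cast_nonneg (Fintype.card F))]
    exact mul_le_mul_of_nonneg_right hsm (Real.sqrt_nonneg _)
  · have hg : g ≠ 0 := by rintro rfl; simp at hD
    obtain ⟨a, ha⟩ : ∃ a, g.eval a ≠ 0 := by
      by_contra! hall
      have h1 : (Finset.univ : Finset F) ⊆ g.roots.toFinset := by
        intro x _
        simp [hg, hall x]
      have h2 := Finset.card_le_card h1
      have h3 := Multiset.toFinset_card_le g.roots
      have h4 := g.card_roots'
      rw [Finset.card_univ] at h2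
      have h5 : Fintype.card F ≤ g.natDegree := by omega
      have h6 : Real.sqrt (Fintype.card F) ≤ g.natDegree := by
        rw [Real.sqrt_le_left (by positivity)]
        have : Fintype.card F ≤ g.natDegree ^ 2 := by nlinarith
        exact_mod_cast this
      have : (0 : ℝ) ≤ g.natDegree := by positivity
      linarith
    have hdeg : (g.comp (X + C a)).natDegree = g.natDegree := by
      rw [natDegree_comp, natDegree_X_add_C, mul_one]
    have hcc : ∀ p : F[X], (p.comp (X + C a)).comp (X - C a) = p := by
      intro p; rw [comp_assoc]; simp
    have hcc' : ∀ p : F[X], (p.comp (X - C a)).comp (X + C a) = p := by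
      intro p; rw [comp_assoc]; simp
    have := weil0 hq (g.comp (X + C a)) (by rw [coeff_zero_eq_eval_zero]; simpa using ha) (by
      intro r s c h
      have h2 := congrArg (fun p => p.comp (X - C a)) h
      simp only [mul_comp, pow_comp, hcc, C_comp] at h2
      have := hsq _ _ _ h2
      rw [← hcc' r, this, zero_comp]) (by rw [hdeg]; exact hD) (by rw [hdeg]; exact hbig)
    rw [hdeg] at this
    convert this using 2
    simp only [eval_comp, eval_add, eval_X, eval_C]
    exact (Equiv.sum_comp (Equiv.addRight a) (fun x => chiR (g.eval x))).symm

theorem polyIter_eval {F : Type*} [Field F] (f : F[X]) (n : ℕ) (x : F) :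
    (polyIter f n).eval x = f.eval^[n] x := by
  induction n with
  | zero => simp [polyIter]
  | succ n ih => rw [polyIter, eval_comp, ih, Function.iterate_succ_apply']

theorem polyIter_natDegree {F : Type*} [Field F] (f : F[X]) (n : ℕ) :
    (polyIter f n).natDegree = f.natDegree ^ n := by
  induction n with
  | zero => simp [polyIter]
  | succ n ih => rw [polyIter, natDegree_comp, ih, pow_succ']

theorem polyIter_ne {F : Type*} [Field F] (f : F[X]) (hd : 2 ≤ f.natDegree) (n : ℕ) :
    polyIter f n ≠ 0 := by
  intro h
  have := polyIter_natDegree f n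
  rw [h, natDegree_zero] at this
  have := Nat.pow_pos (n := n) (show 0 < f.natDegree by omega)
  omega

theorem not_sq {F : Type*} [Field F] (f : F[X]) (hd : 2 ≤ f.natDegree)
    (hf : DynTwoOrdinary f) (S : Finset ℕ) (hS : S.Nonempty) (h1 : ∀ i ∈ S, 1 ≤ i) :
    ∀ r s : F[X], ∀ c : F, (∏ i ∈ S, polyIter f i) * r ^ 2 = C c * s ^ 2 → r = 0 := by
  classical
  intro r s c h
  by_contra hr
  have hmem := S.max'_mem hS
  set M := S.max' hS with hM
  obtain ⟨g, hirr, ⟨e, he, hdvd, hndvd⟩, hlow⟩ := hf M (h1 M hmem)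
  have hp : Prime g := hirr.prime
  have hfin : ∀ p : F[X], p ≠ 0 → FiniteMultiplicity g p := fun p hp0 =>
    FiniteMultiplicity.of_not_isUnit hirr.not_isUnit hp0
  have hG : (∏ i ∈ S, polyIter f i) ≠ 0 := Finset.prod_ne_zero_iff.2 fun i _ => polyIter_ne f hd i
  have hl : (∏ i ∈ S, polyIter f i) * r ^ 2 ≠ 0 := mul_ne_zero hG (pow_ne_zero _ hr)
  have hl2 : C c * s ^ 2 ≠ 0 := h ▸ hl
  have hs : s ≠ 0 := by rintro rfl; simp at hl2
  have hc : c ≠ 0 := by rintro rfl; simp at hl2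
  have hmr : multiplicity g (∏ i ∈ S.erase M, polyIter f i) = 0 := by
    apply multiplicity_eq_zero.2
    intro hdv
    obtain ⟨i, hi, hgi⟩ := (hp.dvd_finsetProd_iff _).1 hdv
    rw [Finset.mem_erase] at hi
    exact hlow i (lt_of_le_of_ne (S.le_max' i hi.2) hi.1) hgi
  have hmM : multiplicity g (polyIter f M) = e := multiplicity_eq_of_dvd_of_not_dvd hdvd hndvd
  have hmC : multiplicity g (C c) = 0 := by
    apply multiplicity_eq_zero.2
    intro hdv
    exact hirr.not_isUnit (isUnit_of_dvd_unit hdv (isUnit_C.2 hc.isUnit))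
  have := congrArg (multiplicity g) h
  rw [multiplicity_mul hp (hfin _ hl), multiplicity_mul hp (hfin _ hl2),
    (hfin _ hr).multiplicity_pow hp, (hfin _ hs).multiplicity_pow hp, hmC,
    ← Finset.mul_prod_erase S _ hmem, multiplicity_mul hp
      (hfin _ (by rw [Finset.mul_prod_erase S _ hmem]; exact hG)), hmr, hmM] at this
  obtain ⟨k, hk⟩ := he
  omega

theorem sum_powerset_w (A : Finset ℕ) (w : ℕ → ℝ) :
    2 * ∑ S ∈ A.powerset, ∑ i ∈ S, w i = 2 ^ A.card * ∑ i ∈ A, w i := by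
  classical
  induction A using Finset.induction_on with
  | empty => simp
  | insert a A ha ih =>
    rw [Finset.sum_powerset_insert ha, Finset.card_insert_of_notMem ha, Finset.sum_insert ha]
    have : ∑ S ∈ A.powerset, ∑ i ∈ insert a S, w i
        = ∑ S ∈ A.powerset, (w a + ∑ i ∈ S, w i) := by
      refine Finset.sum_congr rfl fun S hS => ?_
      rw [Finset.sum_insert fun h => ha (Finset.mem_powerset.1 hS h)]
    rw [this, Finset.sum_add_distrib, Finset.sum_const, Finset.card_powerset, nsmul_eq_mul]
    push_cast
    rw [pow_succ]
    linear_combination 2 * ih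

theorem geom_bd (d L : ℕ) (hd : 2 ≤ d) : ∑ i ∈ Finset.Icc 1 L, d ^ i + 2 ≤ d ^ (L + 1) := by
  induction L with
  | zero => simpa using hd
  | succ L ih =>
    rw [Finset.sum_Icc_succ_top (by omega), pow_succ d (L + 1)]
    have := Nat.mul_le_mul_left (d ^ (L + 1)) hd
    omega

theorem chiR_prod {F : Type*} [Field F] [Fintype F] (S : Finset ℕ) (y : ℕ → F) :
    ∏ i ∈ S, chiR (y i) = chiR (∏ i ∈ S, y i) := by
  classical
  induction S using Finset.induction_on with
  | empty => simp [chiR]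
  | insert a A ha ih => rw [Finset.prod_insert ha, Finset.prod_insert ha, chiR_mul, ih]

theorem square_patterns_stmt16 {F : Type} [Field F] [Fintype F]
    (hq : Odd (Fintype.card F)) (f : F[X]) (hd : 2 ≤ f.natDegree)
    (hf : DynTwoOrdinary f) (L : ℕ) (hL : 1 ≤ L) (ε : ℕ → ℝ)
    (hε : ∀ ℓ : ℕ, 1 ≤ ℓ → ℓ ≤ L → ε ℓ = -1 ∨ ε ℓ = 0 ∨ ε ℓ = 1) :
    ∑ x : F, ∏ ℓ ∈ Finset.Icc 1 L, (1 + ε ℓ * chiR (f.eval^[ℓ] x)) / 2 ≤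
      (Fintype.card F : ℝ) / 2 ^ L +
        (f.natDegree : ℝ) ^ (L + 1) * Real.sqrt (Fintype.card F) := by
  classical
  set t := Real.sqrt (Fintype.card F) with ht
  have ht0 : 0 ≤ t := Real.sqrt_nonneg _
  set I := Finset.Icc 1 L with hI
  have hcard : I.card = L := by simp [hI]
  have hεabs : ∀ i ∈ I, |ε i| ≤ 1 := by
    intro i hi
    rw [hI, Finset.mem_Icc] at hi
    rcases hε i hi.1 hi.2 with h | h | h <;> simp [h]
  have e1 : ∑ x : F, ∏ ℓ ∈ I, (1 + ε ℓ * chiR (f.eval^[ℓ] x)) / 2 =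
      (∑ S ∈ I.powerset, (∏ i ∈ S, ε i) *
        ∑ x : F, chiR ((∏ i ∈ S, polyIter f i).eval x)) / 2 ^ L := by
    simp_rw [Finset.mul_sum]
    rw [Finset.sum_comm, Finset.sum_div]
    refine Finset.sum_congr rfl fun x _ => ?_
    rw [Finset.prod_div_distrib, Finset.prod_const, hcard, Finset.prod_one_add]
    congr 1
    refine Finset.sum_congr rfl fun S _ => ?_
    rw [Finset.prod_mul_distrib, chiR_prod, eval_prod]
    simp_rw [polyIter_eval]
  have e2 : ∀ S ∈ I.powerset, (∏ i ∈ S, ε i) *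
        ∑ x : F, chiR ((∏ i ∈ S, polyIter f i).eval x) ≤
      (if S = ∅ then (Fintype.card F : ℝ) else 0) +
        (2 * (∑ i ∈ S, (f.natDegree : ℝ) ^ i) * t + 2 * t) := by
    intro S hS
    rw [Finset.mem_powerset] at hS
    by_cases h0 : S = ∅
    · subst h0
      simp [chiR, ht0]
    · rw [if_neg h0, zero_add]
      have h1 : ∀ i ∈ S, 1 ≤ i := fun i hi => (Finset.mem_Icc.1 (hS hi)).1
      have hne := Finset.nonempty_iff_ne_empty.2 h0
      have hdeg : (∏ i ∈ S, polyIter f i).natDegree = ∑ i ∈ S, f.natDegree ^ i := by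
        rw [natDegree_prod _ _ fun i _ => polyIter_ne f hd i]
        simp_rw [polyIter_natDegree]
      have hD1 : 1 ≤ (∏ i ∈ S, polyIter f i).natDegree := by
        rw [hdeg]
        obtain ⟨i, hi⟩ := hne
        have h3 := Finset.single_le_sum (f := fun i => f.natDegree ^ i)
          (fun i _ => Nat.zero_le _) hi
        have h4 := Nat.pow_pos (n := i) (show 0 < f.natDegree by omega)
        exact le_trans h4 h3
      have hw := weil hq _ (not_sq f hd hf S hne h1) hD1
      rw [hdeg] at hw
      push_cast at hw
      refine (le_abs_self _).trans ?_
      rw [abs_mul, Finset.abs_prod]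
      have h5 : ∏ i ∈ S, |ε i| ≤ 1 :=
        Finset.prod_le_one (fun i _ => abs_nonneg _) fun i hi => hεabs i (hS hi)
      refine (mul_le_of_le_one_left (abs_nonneg _) h5).trans (hw.trans (le_of_eq ?_))
      ring
  have e3 : ∑ S ∈ I.powerset, ((if S = ∅ then (Fintype.card F : ℝ) else 0) +
        (2 * (∑ i ∈ S, (f.natDegree : ℝ) ^ i) * t + 2 * t)) =
      Fintype.card F + 2 ^ L * ((∑ i ∈ I, (f.natDegree : ℝ) ^ i) + 2) * t := by
    rw [Finset.sum_add_distrib, Finset.sum_add_distrib, Finset.sum_ite_eq',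
      if_pos (Finset.empty_mem_powerset I), ← Finset.sum_mul, ← Finset.mul_sum, sum_powerset_w,
      Finset.sum_const, Finset.card_powerset, nsmul_eq_mul, hcard]
    push_cast
    ring
  have e4 : (∑ i ∈ I, (f.natDegree : ℝ) ^ i) + 2 ≤ (f.natDegree : ℝ) ^ (L + 1) := by
    exact_mod_cast geom_bd f.natDegree L hd
  rw [e1, div_le_iff₀ (by positivity)]
  refine (Finset.sum_le_sum e2).trans ?_
  rw [e3]
  have e5 : (Fintype.card F : ℝ) / 2 ^ L * 2 ^ L = Fintype.card F := by
    field_simp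
  rw [add_mul, e5]
  have e6 := mul_le_mul_of_nonneg_right e4 ht0
  have e7 := mul_le_mul_of_nonneg_right e6 (show (0:ℝ) ≤ 2 ^ L by positivity)
  linarith
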